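/- Suppose g ∈ C²([0,1]) with g'' Lipschitz, f ∈ C²([0,1]) is a probability density with f'' Lipschitz and 0 < inf_{[0,1]} f, K is an even kernel supported in [−1,1], twice continuously differentiable with K'' Lipschitz and ∫_{−1}^1 K = 1, and x ∈ (0,1). Define the bias of the trapezoidal estimator Bias_{n,h}(x) = (1/(2n)) Σ_{k=1}^{N−1} [ (φ_{x,h}·g/f)(t_{x,k}) + (φ_{x,h}·g/f)(t_{x,k+1}) ] − g(x). Then there exist a constant C > 0 and a function ρ : (0,1) → [0,∞) with ρ(h) → 0 as h → 0⁺ such that, for all n and all h with nh ≥ 1 and [x−h,x+h] ⊆ [0,1], |Bias_{n,h}(x) − (1/2) h² g''(x) B| ≤ ρ(h) h² + C/(n³h³), where B = ∫_{−1}^1 t²K(t)dt. Equivalently, Bias_{n,h}(x) = (1/2)h²g''(x)B + o(h²) + O(1/(n³h³)) as h → 0 and nh → ∞. -/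

import Mathlib

open MeasureTheory Filter
open scoped Classical Topology

/-- The scaled kernel φ_{x,h}(s) = (1/h) K((x−s)/h). -/
noncomputable def phiK (K : ℝ → ℝ) (x h s : ℝ) : ℝ := (1 / h) * K ((x - s) / h)

/-- Indices of consecutive pairs of design points both lying in [x−h, x+h]. -/
noncomputable def trapIdx (t : ℕ → ℕ → ℝ) (n : ℕ) (x h : ℝ) : Finset ℕ :=
  (Finset.Icc 1 (n - 1)).filter
    (fun i => t n i ∈ Set.Icc (x - h) (x + h) ∧ t n (i + 1) ∈ Set.Icc (x - h) (x + h))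

/-- The trapezoidal sum (1/(2n)) Σ_{k=1}^{N−1} (G(t_{x,k}) + G(t_{x,k+1})). -/
noncomputable def trapSum (t : ℕ → ℕ → ℝ) (n : ℕ) (x h : ℝ) (G : ℝ → ℝ) : ℝ :=
  (1 / (2 * (n : ℝ))) * ∑ i ∈ trapIdx t n x h, (G (t n i) + G (t n (i + 1)))

/-- Third order Taylor bound at a point where a function and its first two derivatives vanish. -/
lemma taylor_bound_of_lipschitz {S : Set ℝ} (hS : Convex ℝ S) {r r₁ r₂ : ℝ → ℝ} {L e : ℝ}
    (he : e ∈ S) (hr : ∀ s ∈ S, HasDerivWithinAt r (r₁ s) S s)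
    (hr₁ : ∀ s ∈ S, HasDerivWithinAt r₁ (r₂ s) S s)
    (hL : 0 ≤ L) (hr₂ : ∀ s ∈ S, |r₂ s| ≤ L * |s - e|) (h0 : r e = 0) (h1 : r₁ e = 0)
    {v : ℝ} (hv : v ∈ S) :
    |r₁ v| ≤ L * |v - e| ^ 2 ∧ |r v| ≤ L * |v - e| ^ 3 := by
  have hseg : ∀ v ∈ S, segment ℝ e v ⊆ S := fun v hv => hS.segment_subset he hv
  have hdist : ∀ v, ∀ s ∈ segment ℝ e v, |s - e| ≤ |v - e| := by
    intro v s hs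
    rw [segment_eq_uIcc] at hs
    exact Set.abs_sub_left_of_mem_uIcc hs
  have key1 : ∀ v ∈ S, |r₁ v| ≤ L * |v - e| ^ 2 := by
    intro v hv
    have := (convex_segment e v).norm_image_sub_le_of_norm_hasDerivWithin_le (𝕜 := ℝ)
      (f := r₁) (f' := r₂) (C := L * |v - e|)
      (fun s hs => (hr₁ s (hseg v hv hs)).mono (hseg v hv))
      (fun s hs => (hr₂ s (hseg v hv hs)).trans
        (mul_le_mul_of_nonneg_left (hdist v s hs) hL))
      (left_mem_segment ℝ e v) (right_mem_segment ℝ e v)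
    rw [h1, sub_zero, Real.norm_eq_abs, Real.norm_eq_abs] at this
    linarith [this, (by ring : L * |v - e| * |v - e| = L * |v - e| ^ 2)]
  refine ⟨key1 v hv, ?_⟩
  have := (convex_segment e v).norm_image_sub_le_of_norm_hasDerivWithin_le (𝕜 := ℝ)
    (f := r) (f' := r₁) (C := L * |v - e| ^ 2)
    (fun s hs => (hr s (hseg v hv hs)).mono (hseg v hv))
    (fun s hs => (key1 s (hseg v hv hs)).trans
      (mul_le_mul_of_nonneg_left (pow_le_pow_left₀ (abs_nonneg _) (hdist v s hs) 2) hL))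
    (left_mem_segment ℝ e v) (right_mem_segment ℝ e v)
  rw [h0, sub_zero, Real.norm_eq_abs, Real.norm_eq_abs] at this
  linarith [this, (by ring : L * |v - e| ^ 2 * |v - e| = L * |v - e| ^ 3)]

/-- Corrected trapezoidal rule with respect to the measure `dF` on one cell of mass `δ`, where
`D` and `E` are the first two derivatives of `G` with respect to `F`. -/
lemma trapezoid_cell_error {a b δ M κ L : ℝ} (hab : a ≤ b) {F f G D E I : ℝ → ℝ}
    (hF : ∀ s ∈ Set.Icc a b, HasDerivWithinAt F (f s) (Set.Icc a b) s)
    (hG : ∀ s ∈ Set.Icc a b, HasDerivWithinAt G (D s * f s) (Set.Icc a b) s)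
    (hD : ∀ s ∈ Set.Icc a b, HasDerivWithinAt D (E s * f s) (Set.Icc a b) s)
    (hI : ∀ s ∈ Set.Icc a b, HasDerivWithinAt I (G s * f s) (Set.Icc a b) s)
    (hE : ∀ s ∈ Set.Icc a b, |E s - E a| ≤ L * |s - a|)
    (hL : 0 ≤ L) (hfM : ∀ s ∈ Set.Icc a b, |f s| ≤ M)
    (hFδ : F b - F a = δ) (hFmem : ∀ s ∈ Set.Icc a b, F s ∈ Set.Icc (F a) (F b))
    (hκ : b - a ≤ κ * δ) :
    |δ / 2 * (G a + G b) - δ ^ 2 / 12 * (D b - D a) - (I b - I a)|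
      ≤ L * M * κ * δ ^ 3 * (b - a) := by
  set m := (F a + F b) / 2 with hm
  have hT : ∀ s ∈ Set.Icc a b, HasDerivWithinAt
      (fun s => G s * (F s - m) - D s * ((F s - m) ^ 2 / 2 - δ ^ 2 / 8) - δ ^ 2 / 12 * D s
        + E a * ((F s - m) ^ 3 / 6 - δ ^ 2 / 24 * (F s - m)) - I s)
      (-(E s - E a) * ((F s - m) ^ 2 / 2 - δ ^ 2 / 24) * f s) (Set.Icc a b) s := by
    intro s hs
    have hP := (hF s hs).sub_const m
    have h := ((((hG s hs).mul hP).sub ((hD s hs).mul (((hP.pow 2).div_const 2).sub_const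
      (δ ^ 2 / 8)))).sub ((hD s hs).const_mul (δ ^ 2 / 12))).add
      ((((hP.pow 3).div_const 6).sub (hP.const_mul (δ ^ 2 / 24))).const_mul (E a)) |>.sub (hI s hs)
    refine h.congr_deriv ?_
    simp only [Pi.pow_apply, Nat.cast_ofNat]
    ring
  have ha : a ∈ Set.Icc a b := Set.left_mem_Icc.2 hab
  have hb : b ∈ Set.Icc a b := Set.right_mem_Icc.2 hab
  have hM : 0 ≤ M := (abs_nonneg _).trans (hfM a ha)
  have hδ : 0 ≤ δ := by have := (hFmem a ha).2; linarith
  have hba : 0 ≤ b - a := by linarith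
  have hbound : ∀ s ∈ Set.Icc a b,
      ‖-(E s - E a) * ((F s - m) ^ 2 / 2 - δ ^ 2 / 24) * f s‖ ≤ L * (b - a) * δ ^ 2 * M := by
    intro s hs
    obtain ⟨h1, h2⟩ := hFmem s hs
    have hsq : (F s - m) ^ 2 ≤ (δ / 2) ^ 2 := by
      apply sq_le_sq'
      · rw [hm]; linarith
      · rw [hm]; linarith
    have hQ : |(F s - m) ^ 2 / 2 - δ ^ 2 / 24| ≤ δ ^ 2 := by
      rw [abs_le]
      constructor <;> nlinarith [sq_nonneg (F s - m), sq_nonneg δ]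
    have hEs : |-(E s - E a)| ≤ L * (b - a) := by
      rw [abs_neg]
      refine (hE s hs).trans (mul_le_mul_of_nonneg_left ?_ hL)
      rw [abs_of_nonneg (by linarith [hs.1])]
      linarith [hs.2]
    rw [Real.norm_eq_abs, abs_mul, abs_mul]
    have := hfM s hs
    gcongr
  have h := (convex_Icc a b).norm_image_sub_le_of_norm_hasDerivWithin_le (𝕜 := ℝ) hT hbound ha hb
  rw [Real.norm_eq_abs, Real.norm_eq_abs, abs_of_nonneg hba] at h
  have hFb : F b - m = δ / 2 := by rw [hm]; linarith
  have hFa : F a - m = -(δ / 2) := by rw [hm]; linarith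
  simp only [hFb, hFa] at h
  have hle : L * (b - a) * δ ^ 2 * M * (b - a) ≤ L * M * κ * δ ^ 3 * (b - a) := by
    have : 0 ≤ L * δ ^ 2 * M * (b - a) := by positivity
    nlinarith [mul_le_mul_of_nonneg_left hκ this]
  refine le_trans (le_of_eq_of_le ?_ h) hle
  congr 1
  ring

/-- Corrected composite trapezoidal rule, summed over consecutive cells. -/
lemma trapezoid_sum_error {τ : ℕ → ℝ} {G D I : ℝ → ℝ} {δ c : ℝ} {p q : ℕ} (hpq : p ≤ q)
    (hcell : ∀ i ∈ Finset.Ico p q,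
      |δ / 2 * (G (τ i) + G (τ (i + 1))) - δ ^ 2 / 12 * (D (τ (i + 1)) - D (τ i))
        - (I (τ (i + 1)) - I (τ i))| ≤ c * (τ (i + 1) - τ i)) :
    |δ / 2 * ∑ i ∈ Finset.Ico p q, (G (τ i) + G (τ (i + 1)))
        - δ ^ 2 / 12 * (D (τ q) - D (τ p)) - (I (τ q) - I (τ p))| ≤ c * (τ q - τ p) := by
  rw [← Finset.sum_Ico_sub (fun i => D (τ i)) hpq, ← Finset.sum_Ico_sub (fun i => I (τ i)) hpq,
    ← Finset.sum_Ico_sub τ hpq, Finset.mul_sum, Finset.mul_sum, Finset.mul_sum,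
    ← Finset.sum_sub_distrib, ← Finset.sum_sub_distrib]
  exact (Finset.abs_sum_le_sum_abs _ _).trans (Finset.sum_le_sum hcell)

/-- The active cells form a block of consecutive indices. -/
lemma trapIdx_eq_Ico {t : ℕ → ℕ → ℝ} {n : ℕ} {x h : ℝ}
    (hmono : StrictMonoOn (t n) (Set.Icc 1 n)) (hne : (trapIdx t n x h).Nonempty) :
    ∃ p q : ℕ, 1 ≤ p ∧ p < q ∧ q ≤ n ∧ trapIdx t n x h = Finset.Ico p q ∧
      t n p ∈ Set.Icc (x - h) (x + h) ∧ t n q ∈ Set.Icc (x - h) (x + h) ∧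
      (p = 1 ∨ t n (p - 1) < x - h) ∧ (q = n ∨ x + h < t n (q + 1)) := by
  have hmem : ∀ i, i ∈ trapIdx t n x h ↔ (1 ≤ i ∧ i ≤ n - 1) ∧
      t n i ∈ Set.Icc (x - h) (x + h) ∧ t n (i + 1) ∈ Set.Icc (x - h) (x + h) := by
    intro i; simp only [trapIdx, Finset.mem_filter, Finset.mem_Icc]
  have hle : ∀ i j, 1 ≤ i → i ≤ j → j ≤ n → t n i ≤ t n j := fun i j h1 h2 h3 =>
    hmono.monotoneOn ⟨h1, h2.trans h3⟩ ⟨h1.trans h2, h3⟩ h2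
  set p := (trapIdx t n x h).min' hne with hp
  set r := (trapIdx t n x h).max' hne with hr
  have hpm := (hmem p).1 (Finset.min'_mem _ hne)
  have hrm := (hmem r).1 (Finset.max'_mem _ hne)
  have hpr : p ≤ r := Finset.min'_le _ _ (Finset.max'_mem _ hne)
  refine ⟨p, r + 1, hpm.1.1, by omega, by omega, ?_, hpm.2.1, hrm.2.2, ?_, ?_⟩
  · ext i
    rw [Finset.mem_Ico]
    constructor
    · intro hi
      exact ⟨Finset.min'_le _ _ hi, Nat.lt_succ_of_le (Finset.le_max' _ _ hi)⟩
    · rintro ⟨h1, h2⟩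
      refine (hmem i).2 ⟨⟨by omega, by omega⟩, ⟨?_, ?_⟩, ?_, ?_⟩
      · exact hpm.2.1.1.trans (hle _ _ (by omega) h1 (by omega))
      · exact (hle _ _ (by omega) (by omega) (by omega)).trans hrm.2.2.2
      · exact hpm.2.1.1.trans (hle _ _ (by omega) (by omega) (by omega))
      · exact (hle _ _ (by omega) (by omega) (by omega)).trans hrm.2.2.2
  · by_contra! hcon
    obtain ⟨h1, h2⟩ := hcon
    have hpos := hpm.1.1
    have : p - 1 ∈ trapIdx t n x h := by
      refine (hmem _).2 ⟨⟨by omega, by omega⟩, ⟨h2, ?_⟩, ?_⟩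
      · exact (hle _ _ (by omega) (by omega) (by omega)).trans hpm.2.1.2
      · rw [Nat.sub_add_cancel hpos]; exact hpm.2.1
    have := Finset.min'_le _ _ this
    omega
  · by_contra! hcon
    obtain ⟨h1, h2⟩ := hcon
    have : r + 1 ∈ trapIdx t n x h := by
      refine (hmem _).2 ⟨⟨by omega, by omega⟩, hrm.2.2, ?_, h2⟩
      exact hrm.2.2.1.trans (hle _ _ (by omega) (by omega) (by omega))
    have := Finset.le_max' _ _ this
    omega

/-- Bounded and Lipschitz on `S`, with a common constant. -/
def IsBddLip (S : Set ℝ) (w : ℝ → ℝ) : Prop :=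
  ∃ M, 0 ≤ M ∧ (∀ s ∈ S, |w s| ≤ M) ∧ ∀ s ∈ S, ∀ s' ∈ S, |w s - w s'| ≤ M * |s - s'|

namespace IsBddLip

variable {S : Set ℝ} {v w : ℝ → ℝ}

lemma of_bounds {M N : ℝ} (hM : ∀ s ∈ S, |w s| ≤ M)
    (hN : ∀ s ∈ S, ∀ s' ∈ S, |w s - w s'| ≤ N * |s - s'|) : IsBddLip S w :=
  ⟨max 0 (max M N), le_max_left _ _,
    fun s hs => (hM s hs).trans ((le_max_left _ _).trans (le_max_right _ _)),
    fun s hs s' hs' => (hN s hs s' hs').trans (mul_le_mul_of_nonneg_right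
      ((le_max_right _ _).trans (le_max_right _ _)) (abs_nonneg _))⟩

lemma const (c : ℝ) : IsBddLip S fun _ => c :=
  of_bounds (M := |c|) (N := 0) (fun _ _ => le_rfl) (fun _ _ _ _ => by simp)

lemma add (hv : IsBddLip S v) (hw : IsBddLip S w) : IsBddLip S fun s => v s + w s := by
  obtain ⟨M, -, h1, h2⟩ := hv
  obtain ⟨N, -, h3, h4⟩ := hw
  refine of_bounds (M := M + N) (N := M + N)
    (fun s hs => (abs_add_le _ _).trans (add_le_add (h1 s hs) (h3 s hs))) fun s hs s' hs' => ?_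
  calc |v s + w s - (v s' + w s')| = |(v s - v s') + (w s - w s')| := by ring_nf
    _ ≤ |v s - v s'| + |w s - w s'| := abs_add_le _ _
    _ ≤ M * |s - s'| + N * |s - s'| := add_le_add (h2 s hs s' hs') (h4 s hs s' hs')
    _ = (M + N) * |s - s'| := by ring

lemma mul (hv : IsBddLip S v) (hw : IsBddLip S w) : IsBddLip S fun s => v s * w s := by
  obtain ⟨M, hM, h1, h2⟩ := hv
  obtain ⟨N, hN, h3, h4⟩ := hw
  refine of_bounds (M := M * N) (N := 2 * (M * N)) (fun s hs => ?_) fun s hs s' hs' => ?_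
  · rw [abs_mul]
    exact mul_le_mul (h1 s hs) (h3 s hs) (abs_nonneg _) hM
  calc |v s * w s - v s' * w s'| = |(v s - v s') * w s + v s' * (w s - w s')| := by ring_nf
    _ ≤ |v s - v s'| * |w s| + |v s'| * |w s - w s'| := by
      rw [← abs_mul, ← abs_mul]; exact abs_add_le _ _
    _ ≤ (M * |s - s'|) * N + M * (N * |s - s'|) := by
      gcongr
      exacts [h2 s hs s' hs', h3 s hs, h1 s' hs', h4 s hs s' hs']
    _ = 2 * (M * N) * |s - s'| := by ring

lemma pow (hv : IsBddLip S v) : ∀ k : ℕ, IsBddLip S fun s => v s ^ k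
  | 0 => by simpa using const 1
  | k + 1 => by simpa only [pow_succ] using (hv.pow k).mul hv

lemma const_mul (c : ℝ) (hv : IsBddLip S v) : IsBddLip S fun s => c * v s := (const c).mul hv

lemma sub (hv : IsBddLip S v) (hw : IsBddLip S w) : IsBddLip S fun s => v s - w s := by
  simpa only [neg_one_mul, ← sub_eq_add_neg] using hv.add (hw.const_mul (-1))

lemma inv {c : ℝ} (hc : 0 < c) (hv : IsBddLip S v) (hvc : ∀ s ∈ S, c ≤ v s) :
    IsBddLip S fun s => (v s)⁻¹ := by
  obtain ⟨M, hM, h1, h2⟩ := hv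
  have hpos : ∀ s ∈ S, 0 < v s := fun s hs => hc.trans_le (hvc s hs)
  have hle : ∀ s ∈ S, |(v s)⁻¹| ≤ c⁻¹ := fun s hs => by
    rw [abs_of_pos (inv_pos.2 (hpos s hs))]
    exact inv_anti₀ hc (hvc s hs)
  refine of_bounds (M := c⁻¹) (N := c⁻¹ * M * c⁻¹) hle fun s hs s' hs' => ?_
  have h : (v s)⁻¹ - (v s')⁻¹ = (v s)⁻¹ * (v s' - v s) * (v s')⁻¹ := by
    have := (hpos s hs).ne'
    have := (hpos s' hs').ne'
    field_simp
  rw [h, abs_mul, abs_mul]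
  calc |(v s)⁻¹| * |v s' - v s| * |(v s')⁻¹| ≤ c⁻¹ * (M * |s - s'|) * c⁻¹ := by
        have := h2 s hs s' hs'
        rw [abs_sub_comm] at this
        have := hle s hs
        have := hle s' hs'
        gcongr
    _ = c⁻¹ * M * c⁻¹ * |s - s'| := by ring

lemma of_lipschitzOnWith (hS : IsCompact S) {L : NNReal} (hw : LipschitzOnWith L w S) :
    IsBddLip S w := by
  obtain ⟨M, hM⟩ := hS.exists_bound_of_continuousOn hw.continuousOn
  exact of_bounds (M := M) (N := L) hM fun s hs s' hs' => hw.norm_sub_le hs hs'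

lemma of_hasDerivWithinAt (hS : IsCompact S) (hconv : Convex ℝ S) {w' : ℝ → ℝ}
    (hw : ∀ s ∈ S, HasDerivWithinAt w (w' s) S s) (hw' : ContinuousOn w' S) : IsBddLip S w := by
  obtain ⟨M, hM⟩ := hS.exists_bound_of_continuousOn (f := w) fun s hs => (hw s hs).continuousWithinAt
  obtain ⟨N, hN⟩ := hS.exists_bound_of_continuousOn hw'
  exact of_bounds (M := M) (N := N) hM fun s hs s' hs' =>
    hconv.norm_image_sub_le_of_norm_hasDerivWithin_le hw hN hs' hs

/-- The product of a rescaled kernel and a weight is Lipschitz with constant of order `1 / h`. -/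
lemma scaled_mul {k : ℝ → ℝ} (hk : IsBddLip (Set.Icc (-1) 1) k) (hw : IsBddLip (Set.Icc 0 1) w) :
    ∃ C, 0 ≤ C ∧ ∀ x h : ℝ, 0 < h → h < 1 → Set.Icc (x - h) (x + h) ⊆ Set.Icc 0 1 →
      ∀ s ∈ Set.Icc (x - h) (x + h), ∀ s' ∈ Set.Icc (x - h) (x + h),
        |k ((x - s) / h) * w s - k ((x - s') / h) * w s'| ≤ C / h * |s - s'| := by
  obtain ⟨M, hM, h1, h2⟩ := hk
  obtain ⟨N, hN, h3, h4⟩ := hw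
  refine ⟨2 * (M * N), by positivity, fun x h hh hh1 hsub s hs s' hs' => ?_⟩
  have hmem : ∀ s ∈ Set.Icc (x - h) (x + h), (x - s) / h ∈ Set.Icc (-1 : ℝ) 1 := by
    intro s hs
    rw [Set.mem_Icc, le_div_iff₀ hh, div_le_iff₀ hh]
    constructor <;> linarith [hs.1, hs.2]
  have hk' : |k ((x - s) / h) - k ((x - s') / h)| ≤ M * (|s - s'| / h) := by
    refine (h2 _ (hmem s hs) _ (hmem s' hs')).trans_eq ?_
    rw [← sub_div, abs_div, abs_of_pos hh, sub_sub_sub_cancel_left, abs_sub_comm]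
  have hdiv : |s - s'| ≤ |s - s'| / h := by
    rw [le_div_iff₀ hh]
    nlinarith [abs_nonneg (s - s')]
  calc |k ((x - s) / h) * w s - k ((x - s') / h) * w s'|
      = |(k ((x - s) / h) - k ((x - s') / h)) * w s + k ((x - s') / h) * (w s - w s')| := by
        ring_nf
    _ ≤ |k ((x - s) / h) - k ((x - s') / h)| * |w s| + |k ((x - s') / h)| * |w s - w s'| := by
      rw [← abs_mul, ← abs_mul]; exact abs_add_le _ _
    _ ≤ (M * (|s - s'| / h)) * N + M * (N * (|s - s'| / h)) := by
      have e1 := h3 s (hsub hs)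
      have e2 := h1 _ (hmem s' hs')
      have e3 := (h4 s (hsub hs) s' (hsub hs')).trans (mul_le_mul_of_nonneg_left hdiv hN)
      gcongr
    _ = 2 * (M * N) / h * |s - s'| := by ring

end IsBddLip

lemma hasDerivWithinAt_integral_Icc {w : ℝ → ℝ} (hw : ContinuousOn w (Set.Icc 0 1)) :
    ∀ s ∈ Set.Icc (0 : ℝ) 1,
      HasDerivWithinAt (fun u => ∫ r in (0 : ℝ)..u, w r) (w s) (Set.Icc 0 1) s := by
  intro s hs
  set W := Set.IccExtend (zero_le_one (α := ℝ)) ((Set.Icc (0 : ℝ) 1).domRestrict w) with hW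
  have hWc : Continuous W := hw.domRestrict.Icc_extend'
  have hWw : ∀ r ∈ Set.Icc (0 : ℝ) 1, W r = w r := fun r hr => by
    rw [hW, Set.IccExtend_of_mem _ _ hr, Set.domRestrict_apply]
  have hint : ∀ u ∈ Set.Icc (0 : ℝ) 1, ∫ r in (0 : ℝ)..u, w r = ∫ r in (0 : ℝ)..u, W r := by
    intro u hu
    refine intervalIntegral.integral_congr fun r hr => ?_
    rw [Set.uIcc_of_le hu.1] at hr
    exact (hWw r ⟨hr.1, hr.2.trans hu.2⟩).symm
  rw [← hWw s hs]
  exact (hWc.integral_hasStrictDerivAt 0 s).hasDerivAt.hasDerivWithinAt.congr hint (hint s hs)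

lemma integral_sub_eq_of_mem_Icc {w : ℝ → ℝ} (hw : ContinuousOn w (Set.Icc 0 1)) {a b : ℝ}
    (ha : a ∈ Set.Icc (0 : ℝ) 1) (hb : b ∈ Set.Icc (0 : ℝ) 1) :
    (∫ r in (0 : ℝ)..b, w r) - ∫ r in (0 : ℝ)..a, w r = ∫ r in a..b, w r := by
  have h0 : (0 : ℝ) ∈ Set.Icc (0 : ℝ) 1 := by simp
  exact intervalIntegral.integral_interval_sub_left
    (hw.mono (Set.uIcc_subset_Icc h0 hb)).intervalIntegrable
    (hw.mono (Set.uIcc_subset_Icc h0 ha)).intervalIntegrable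

lemma mul_sub_le_integral_sub {f : ℝ → ℝ} {c a b : ℝ} (hf : ContinuousOn f (Set.Icc 0 1))
    (hc : ∀ s ∈ Set.Icc (0 : ℝ) 1, c ≤ f s) (ha : a ∈ Set.Icc (0 : ℝ) 1)
    (hb : b ∈ Set.Icc (0 : ℝ) 1) (hab : a ≤ b) :
    c * (b - a) ≤ (∫ r in (0 : ℝ)..b, f r) - ∫ r in (0 : ℝ)..a, f r := by
  rw [integral_sub_eq_of_mem_Icc hf ha hb]
  have h := intervalIntegral.integral_mono_on (μ := volume) (f := fun _ => c) (g := f)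
    hab intervalIntegrable_const
    (hf.mono (Set.uIcc_subset_Icc ha hb)).intervalIntegrable
    (fun s hs => hc s ⟨ha.1.trans hs.1, hs.2.trans hb.2⟩)
  rw [intervalIntegral.integral_const, smul_eq_mul] at h
  linarith

/-- The derivative chain of a `C²` function on the unit interval. -/
lemma ContDiffOn.exists_deriv_chain_Icc {w : ℝ → ℝ} (hw : ContDiffOn ℝ 2 w (Set.Icc 0 1)) :
    ∃ w₁ : ℝ → ℝ, (∀ s ∈ Set.Icc (0 : ℝ) 1, HasDerivWithinAt w (w₁ s) (Set.Icc 0 1) s) ∧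
      ∀ s ∈ Set.Icc (0 : ℝ) 1,
        HasDerivWithinAt w₁ (iteratedDerivWithin 2 w (Set.Icc 0 1) s) (Set.Icc 0 1) s := by
  have hu : UniqueDiffOn ℝ (Set.Icc (0 : ℝ) 1) := uniqueDiffOn_Icc zero_lt_one
  refine ⟨iteratedDerivWithin 1 w (Set.Icc 0 1), fun s hs => ?_, fun s hs => ?_⟩
  · rw [iteratedDerivWithin_one]
    exact (hw.differentiableOn (by norm_num) s hs).hasDerivWithinAt
  · rw [show iteratedDerivWithin 2 w (Set.Icc 0 1)
      = derivWithin (iteratedDerivWithin 1 w (Set.Icc 0 1)) (Set.Icc 0 1)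
      from iteratedDerivWithin_succ]
    exact (hw.differentiableOn_iteratedDerivWithin (m := 1) (by norm_num) hu s hs).hasDerivWithinAt

lemma ContDiff.hasDerivAt_chain {K : ℝ → ℝ} (hK : ContDiff ℝ 2 K) :
    (∀ u, HasDerivAt K (deriv K u) u) ∧ ∀ u, HasDerivAt (deriv K) (iteratedDeriv 2 K u) u := by
  refine ⟨fun u => (hK.differentiable (by norm_num) u).hasDerivAt, fun u => ?_⟩
  rw [show (2 : ℕ) = 1 + 1 from rfl, iteratedDeriv_succ, iteratedDeriv_one]
  have := hK.differentiable_iteratedDeriv 1 (by norm_num)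
  rw [iteratedDeriv_one] at this
  exact (this u).hasDerivAt

/-- A `C²` kernel vanishing off `[-1, 1]` vanishes to second order at the endpoints. -/
lemma kernel_endpoint_bounds {K : ℝ → ℝ} (hK : ContDiff ℝ 2 K)
    (hsupp : ∀ u : ℝ, u ∉ Set.Icc (-1 : ℝ) 1 → K u = 0)
    (hLip : ∃ L : NNReal, LipschitzOnWith L (iteratedDeriv 2 K) (Set.Icc (-1 : ℝ) 1)) :
    ∃ L, 0 ≤ L ∧ ∀ e : ℝ, e = 1 ∨ e = -1 → ∀ v ∈ Set.Icc (-1 : ℝ) 1,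
      |deriv K v| ≤ L * |v - e| ^ 2 ∧ |K v| ≤ L * |v - e| ^ 3 := by
  obtain ⟨L, hL⟩ := hLip
  obtain ⟨h1, h2⟩ := hK.hasDerivAt_chain
  refine ⟨L, L.2, fun e he v hv => ?_⟩
  have hvanish : K e = 0 ∧ deriv K e = 0 ∧ iteratedDeriv 2 K e = 0 := by
    obtain ⟨U, hU, hUK, heU⟩ : ∃ U : Set ℝ, IsOpen U ∧ Set.EqOn K 0 U ∧ e ∈ closure U := by
      rcases he with rfl | rfl
      · exact ⟨Set.Ioi 1, isOpen_Ioi, fun u hu => hsupp u fun h => not_le.2 hu h.2, by simp⟩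
      · exact ⟨Set.Iio (-1), isOpen_Iio, fun u hu => hsupp u fun h => not_le.2 hu h.1, by simp⟩
    have hU1 : Set.EqOn (deriv K) 0 U := fun u hu => by
      rw [hUK.deriv hU hu]; simp
    have hU2 : Set.EqOn (iteratedDeriv 2 K) 0 U := fun u hu => by
      rw [← (h2 u).deriv, hU1.deriv hU hu]; simp
    exact ⟨hUK.closure hK.continuous continuous_zero heU,
      hU1.closure (hK.continuous_deriv (by norm_num)) continuous_zero heU,
      hU2.closure (hK.continuous_iteratedDeriv 2 (by norm_num)) continuous_zero heU⟩
  have heI : e ∈ Set.Icc (-1 : ℝ) 1 := by rcases he with rfl | rfl <;> simp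
  refine taylor_bound_of_lipschitz (convex_Icc _ _) heI (fun s _ => (h1 s).hasDerivWithinAt)
    (fun s _ => (h2 s).hasDerivWithinAt) L.2 (fun s hs => ?_) hvanish.1 hvanish.2.1 hv
  have := hL.norm_sub_le hs heI
  rwa [hvanish.2.2, sub_zero] at this

/-- Second order expansion of the smoothing bias of an even kernel. -/
lemma kernel_smoothing_expansion {g : ℝ → ℝ} (hg : ContDiffOn ℝ 2 g (Set.Icc 0 1))
    (hg_lip : ∃ L : NNReal,
      LipschitzOnWith L (iteratedDerivWithin 2 g (Set.Icc 0 1)) (Set.Icc 0 1))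
    {K : ℝ → ℝ} (hKc : Continuous K) (hK_even : ∀ u, K (-u) = K u)
    (hK_int : ∫ u in (-1 : ℝ)..1, K u = 1) :
    ∃ C, 0 ≤ C ∧ ∀ x h : ℝ, 0 < h → Set.Icc (x - h) (x + h) ⊆ Set.Icc 0 1 →
      |(∫ s in (x - h)..(x + h), phiK K x h s * g s) - g x
        - (1 / 2) * h ^ 2 * iteratedDerivWithin 2 g (Set.Icc 0 1) x
          * ∫ u in (-1 : ℝ)..1, u ^ 2 * K u| ≤ C * h ^ 3 := by
  obtain ⟨L, hL⟩ := hg_lip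
  obtain ⟨g₁, hg1, hg2⟩ := hg.exists_deriv_chain_Icc
  set g₂ := iteratedDerivWithin 2 g (Set.Icc 0 1) with hg₂
  obtain ⟨M, hM⟩ := (isCompact_Icc (a := (-1 : ℝ)) (b := 1)).exists_bound_of_continuousOn
    hKc.continuousOn
  have hM0 : 0 ≤ M := (norm_nonneg _).trans (hM 0 (by simp))
  refine ⟨2 * (M * L), by positivity, fun x h hh hsub => ?_⟩
  have hx : x ∈ Set.Icc (0 : ℝ) 1 := hsub ⟨by linarith, by linarith⟩
  have hmem : ∀ u ∈ Set.Icc (-1 : ℝ) 1, x + h * u ∈ Set.Icc (0 : ℝ) 1 := fun u hu =>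
    hsub ⟨by nlinarith [hu.1], by nlinarith [hu.2]⟩
  have hcov : ∫ s in (x - h)..(x + h), phiK K x h s * g s
      = ∫ u in (-1 : ℝ)..1, K u * g (x + h * u) := by
    have h1 := intervalIntegral.integral_comp_add_mul (a := -1) (b := 1)
      (fun s => phiK K x h s * g s) hh.ne' x
    rw [show x + h * -1 = x - h by ring, mul_one, smul_eq_mul] at h1
    have h2 : ∫ s in (x - h)..(x + h), phiK K x h s * g s
        = h * ∫ u in (-1 : ℝ)..1, phiK K x h (x + h * u) * g (x + h * u) := by
      rw [h1, mul_inv_cancel_left₀ hh.ne']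
    rw [h2, ← intervalIntegral.integral_const_mul]
    congr 1
    funext u
    have : (x - (x + h * u)) / h = -u := by field_simp; ring
    rw [phiK, this, hK_even]
    field_simp
  have hodd : ∫ u in (-1 : ℝ)..1, K u * u = 0 := by
    have h1 := intervalIntegral.integral_comp_neg (a := -1) (b := 1) (fun u => K u * u)
    simp only [hK_even, mul_neg, intervalIntegral.integral_neg, neg_neg] at h1
    linarith
  have hint : IntervalIntegrable (fun u => K u * g (x + h * u)) volume (-1) 1 := by
    refine ContinuousOn.intervalIntegrable (hKc.continuousOn.mul ?_)
    rw [Set.uIcc_of_le (by norm_num)]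
    exact hg.continuousOn.comp (by fun_prop) hmem
  have hrem : (∫ u in (-1 : ℝ)..1, K u * g (x + h * u)) - g x
      - (1 / 2) * h ^ 2 * g₂ x * (∫ u in (-1 : ℝ)..1, u ^ 2 * K u)
      = ∫ u in (-1 : ℝ)..1, K u * (g (x + h * u) - g x - g₁ x * (x + h * u - x)
        - g₂ x / 2 * (x + h * u - x) ^ 2) := by
    have hsplit : ∀ u, K u * (g (x + h * u) - g x - g₁ x * (x + h * u - x)
        - g₂ x / 2 * (x + h * u - x) ^ 2) = K u * g (x + h * u) - (g x * K u
          + (g₁ x * h) * (K u * u) + ((1 / 2) * h ^ 2 * g₂ x) * (u ^ 2 * K u)) := fun u => by ring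
    have i1 : IntervalIntegrable (fun u => g x * K u) volume (-1) 1 :=
      Continuous.intervalIntegrable (by fun_prop) _ _
    have i2 : IntervalIntegrable (fun u => (g₁ x * h) * (K u * u)) volume (-1) 1 :=
      Continuous.intervalIntegrable (by fun_prop) _ _
    have i3 : IntervalIntegrable (fun u => ((1 / 2) * h ^ 2 * g₂ x) * (u ^ 2 * K u))
        volume (-1) 1 := Continuous.intervalIntegrable (by fun_prop) _ _
    simp only [hsplit]
    rw [intervalIntegral.integral_sub hint ((i1.add i2).add i3),
      intervalIntegral.integral_add (i1.add i2) i3, intervalIntegral.integral_add i1 i2,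
      intervalIntegral.integral_const_mul, intervalIntegral.integral_const_mul,
      intervalIntegral.integral_const_mul, hK_int, hodd]
    ring
  rw [hcov, hrem]
  have htaylor : ∀ s ∈ Set.Icc (0 : ℝ) 1,
      |g s - g x - g₁ x * (s - x) - g₂ x / 2 * (s - x) ^ 2| ≤ L * |s - x| ^ 3 := by
    intro s hs
    refine (taylor_bound_of_lipschitz (convex_Icc (0 : ℝ) 1) hx
      (r := fun s => g s - g x - g₁ x * (s - x) - g₂ x / 2 * (s - x) ^ 2)
      (r₁ := fun s => g₁ s - g₁ x - g₂ x * (s - x)) (r₂ := fun s => g₂ s - g₂ x)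
      (fun s hs => ?_) (fun s hs => ?_) L.2 (fun s hs => hL.norm_sub_le hs hx)
      (by simp) (by simp) hs).2
    · have hid := (hasDerivWithinAt_id s (Set.Icc (0 : ℝ) 1)).sub_const x
      refine ((((hg1 s hs).sub_const (g x)).sub (hid.const_mul (g₁ x))).sub
        ((hid.pow 2).const_mul (g₂ x / 2))).congr_deriv ?_
      simp
      ring
    · have hid := (hasDerivWithinAt_id s (Set.Icc (0 : ℝ) 1)).sub_const x
      exact (((hg2 s hs).sub_const (g₁ x)).sub (hid.const_mul (g₂ x))).congr_deriv (by simp)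
  have hbd := intervalIntegral.norm_integral_le_of_norm_le_const (a := -1) (b := 1)
    (C := M * (L * h ^ 3)) (f := fun u => K u * (g (x + h * u) - g x - g₁ x * (x + h * u - x)
        - g₂ x / 2 * (x + h * u - x) ^ 2)) fun u hu => by
      rw [Set.uIoc_of_le (by norm_num)] at hu
      have hu' : u ∈ Set.Icc (-1 : ℝ) 1 := ⟨hu.1.le, hu.2⟩
      rw [norm_mul]
      refine mul_le_mul (hM u hu') ((htaylor _ (hmem u hu')).trans ?_) (norm_nonneg _) hM0
      refine mul_le_mul_of_nonneg_left (pow_le_pow_left₀ (abs_nonneg _) ?_ 3) L.2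
      rw [add_sub_cancel_left, abs_mul, abs_of_pos hh]
      exact mul_le_of_le_one_right hh.le (abs_le.2 ⟨hu'.1, hu'.2⟩)
  refine hbd.trans_eq ?_
  norm_num
  ring

/-- Weights appearing when `g / f` is differentiated twice with respect to the cdf of `f`. -/
lemma exists_design_weights {f g : ℝ → ℝ} {cf : ℝ} (hcf : 0 < cf)
    (hf_lb : ∀ s ∈ Set.Icc (0 : ℝ) 1, cf ≤ f s)
    (hf : ContDiffOn ℝ 2 f (Set.Icc 0 1))
    (hf_lip : ∃ L : NNReal,
      LipschitzOnWith L (iteratedDerivWithin 2 f (Set.Icc 0 1)) (Set.Icc 0 1))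
    (hg : ContDiffOn ℝ 2 g (Set.Icc 0 1))
    (hg_lip : ∃ L : NNReal,
      LipschitzOnWith L (iteratedDerivWithin 2 g (Set.Icc 0 1)) (Set.Icc 0 1)) :
    ∃ A m a b c : ℝ → ℝ, IsBddLip (Set.Icc 0 1) A ∧ IsBddLip (Set.Icc 0 1) m ∧
      IsBddLip (Set.Icc 0 1) a ∧ IsBddLip (Set.Icc 0 1) b ∧ IsBddLip (Set.Icc 0 1) c ∧
      (∀ s ∈ Set.Icc (0 : ℝ) 1,
        HasDerivWithinAt (fun s => g s / f s) (m s * f s) (Set.Icc 0 1) s) ∧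
      (∀ s ∈ Set.Icc (0 : ℝ) 1, HasDerivWithinAt A (-(b s * f s) - m s) (Set.Icc 0 1) s) ∧
      (∀ s ∈ Set.Icc (0 : ℝ) 1, HasDerivWithinAt m (c s * f s) (Set.Icc 0 1) s) ∧
      (∀ s ∈ Set.Icc (0 : ℝ) 1, g s / f s = A s * f s) ∧
      ∀ s ∈ Set.Icc (0 : ℝ) 1, A s = a s * f s := by
  obtain ⟨f₁, hf1, hf2⟩ := hf.exists_deriv_chain_Icc
  obtain ⟨g₁, hg1, hg2⟩ := hg.exists_deriv_chain_Icc
  obtain ⟨Lf, hLf⟩ := hf_lip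
  obtain ⟨Lg, hLg⟩ := hg_lip
  set f₂ := iteratedDerivWithin 2 f (Set.Icc 0 1)
  set g₂ := iteratedDerivWithin 2 g (Set.Icc 0 1)
  have hcomp : IsCompact (Set.Icc (0 : ℝ) 1) := isCompact_Icc
  have hconv : Convex ℝ (Set.Icc (0 : ℝ) 1) := convex_Icc 0 1
  have Bf2 := IsBddLip.of_lipschitzOnWith hcomp hLf
  have Bg2 := IsBddLip.of_lipschitzOnWith hcomp hLg
  have Bf1 := IsBddLip.of_hasDerivWithinAt hcomp hconv hf2 hLf.continuousOn
  have Bg1 := IsBddLip.of_hasDerivWithinAt hcomp hconv hg2 hLg.continuousOn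
  have Bf := IsBddLip.of_hasDerivWithinAt hcomp hconv hf1
    fun s hs => (hf2 s hs).continuousWithinAt
  have Bg := IsBddLip.of_hasDerivWithinAt hcomp hconv hg1
    fun s hs => (hg2 s hs).continuousWithinAt
  have hne : ∀ s ∈ Set.Icc (0 : ℝ) 1, f s ≠ 0 := fun s hs => (hcf.trans_le (hf_lb s hs)).ne'
  obtain ⟨p, hp⟩ : ∃ p : ℝ → ℝ, p = fun s => (f s)⁻¹ := ⟨_, rfl⟩
  have Bp : IsBddLip (Set.Icc 0 1) p := by rw [hp]; exact Bf.inv hcf hf_lb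
  have hpf : ∀ s ∈ Set.Icc (0 : ℝ) 1, p s * f s = 1 := fun s hs => by
    rw [hp]; exact inv_mul_cancel₀ (hne s hs)
  have hp1 : ∀ s ∈ Set.Icc (0 : ℝ) 1,
      HasDerivWithinAt p (-(f₁ s * p s ^ 2)) (Set.Icc 0 1) s := fun s hs => by
    rw [hp]
    refine ((hf1 s hs).inv (hne s hs)).congr_deriv ?_
    have := hne s hs
    field_simp
  refine ⟨fun s => g s * p s ^ 2, fun s => g₁ s * p s ^ 2 - g s * f₁ s * p s ^ 3,
    fun s => g s * p s ^ 3,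
    fun s => 3 * (g s * f₁ s * p s ^ 4) - 2 * (g₁ s * p s ^ 3),
    fun s => g₂ s * p s ^ 3 - 3 * (g₁ s * f₁ s * p s ^ 4) - g s * f₂ s * p s ^ 4
      + 3 * (g s * f₁ s ^ 2 * p s ^ 5),
    Bg.mul (Bp.pow 2), (Bg1.mul (Bp.pow 2)).sub ((Bg.mul Bf1).mul (Bp.pow 3)),
    Bg.mul (Bp.pow 3),
    (((Bg.mul Bf1).mul (Bp.pow 4)).const_mul 3).sub ((Bg1.mul (Bp.pow 3)).const_mul 2),
    (((Bg2.mul (Bp.pow 3)).sub (((Bg1.mul Bf1).mul (Bp.pow 4)).const_mul 3)).sub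
      ((Bg.mul Bf2).mul (Bp.pow 4))).add (((Bg.mul (Bf1.pow 2)).mul (Bp.pow 5)).const_mul 3),
    fun s hs => ?_, fun s hs => ?_, fun s hs => ?_, fun s hs => ?_, fun s hs => ?_⟩
  · have h : (fun s => g s / f s) = fun s => g s * p s := by
      funext s; rw [hp, div_eq_mul_inv]
    rw [h]
    refine ((hg1 s hs).mul (hp1 s hs)).congr_deriv ?_
    linear_combination (-(g₁ s * p s) + g s * f₁ s * p s ^ 2) * hpf s hs
  · refine ((hg1 s hs).mul ((hp1 s hs).pow 2)).congr_deriv ?_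
    simp only [Pi.pow_apply, Nat.cast_ofNat]
    linear_combination (3 * g s * f₁ s * p s ^ 3 - 2 * g₁ s * p s ^ 2) * hpf s hs
  · have hgf : HasDerivWithinAt (fun s => g s * f₁ s) (g₁ s * f₁ s + g s * f₂ s)
        (Set.Icc 0 1) s := (hg1 s hs).mul (hf2 s hs)
    refine (((hg2 s hs).mul ((hp1 s hs).pow 2)).sub
      (hgf.mul ((hp1 s hs).pow 3))).congr_deriv ?_
    simp only [Pi.pow_apply, Nat.cast_ofNat]
    linear_combination (-(g₂ s * p s ^ 2) + 3 * g₁ s * f₁ s * p s ^ 3 + g s * f₂ s * p s ^ 3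
      - 3 * g s * f₁ s ^ 2 * p s ^ 4) * hpf s hs
  · rw [div_eq_mul_inv, show (f s)⁻¹ = p s by rw [hp]]
    linear_combination (-(g s * p s)) * hpf s hs
  · linear_combination (-(g s * p s ^ 2)) * hpf s hs

lemma hasDerivWithinAt_scaled_mul {k k' w : ℝ → ℝ} {w' x h s : ℝ} {S : Set ℝ}
    (hk : ∀ u, HasDerivAt k (k' u) u) (hw : HasDerivWithinAt w w' S s) :
    HasDerivWithinAt (fun s => k ((x - s) / h) * w s)
      (-(1 / h) * (k' ((x - s) / h) * w s) + k ((x - s) / h) * w') S s := by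
  have hv : HasDerivWithinAt (fun s : ℝ => (x - s) / h) (-1 / h) S s :=
    ((hasDerivWithinAt_id s S).const_sub x).div_const h
  refine (((hk _).comp_hasDerivWithinAt s hv).mul hw).congr_deriv ?_
  simp only [Function.comp]
  ring

/-- A combination of rescaled kernels of the type of a second derivative is Lipschitz with constant
of order `h⁻⁴`. -/
lemma IsBddLip.scaled_combination {k k₁ k₂ a b c : ℝ → ℝ}
    (Bk₂ : IsBddLip (Set.Icc (-1) 1) k₂) (Bk₁ : IsBddLip (Set.Icc (-1) 1) k₁)
    (Bk : IsBddLip (Set.Icc (-1) 1) k) (Ba : IsBddLip (Set.Icc 0 1) a)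
    (Bb : IsBddLip (Set.Icc 0 1) b) (Bc : IsBddLip (Set.Icc 0 1) c) :
    ∃ C, 0 ≤ C ∧ ∀ x h : ℝ, 0 < h → h < 1 → Set.Icc (x - h) (x + h) ⊆ Set.Icc 0 1 →
      ∀ s ∈ Set.Icc (x - h) (x + h), ∀ s' ∈ Set.Icc (x - h) (x + h),
        |1 / h * ((1 / h) ^ 2 * (k₂ ((x - s) / h) * a s) + 1 / h * (k₁ ((x - s) / h) * b s)
            + k ((x - s) / h) * c s)
          - 1 / h * ((1 / h) ^ 2 * (k₂ ((x - s') / h) * a s') + 1 / h * (k₁ ((x - s') / h) * b s')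
            + k ((x - s') / h) * c s')| ≤ C / h ^ 4 * |s - s'| := by
  obtain ⟨C₂, hC₂, hlip2⟩ := Bk₂.scaled_mul Ba
  obtain ⟨C₁, hC₁, hlip1⟩ := Bk₁.scaled_mul Bb
  obtain ⟨C₀, hC₀, hlip0⟩ := Bk.scaled_mul Bc
  refine ⟨C₂ + C₁ + C₀, by positivity, fun x h hh hh1 hsub s hs s' hs' => ?_⟩
  have e2 := hlip2 x h hh hh1 hsub s hs s' hs'
  have e1 := hlip1 x h hh hh1 hsub s hs s' hs'
  have e0 := hlip0 x h hh hh1 hsub s hs s' hs'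
  have hinv : 1 ≤ 1 / h := by rw [le_div_iff₀ hh]; linarith
  set y := 1 / h with hy
  have hy0 : 0 ≤ y := by linarith
  set d := |s - s'|
  have hd : 0 ≤ d := abs_nonneg _
  have hC : ∀ C : ℝ, C / h = C * y := fun C => by rw [hy]; ring
  rw [hC C₂] at e2
  rw [hC C₁] at e1
  rw [hC C₀] at e0
  have hC4 : ∀ C : ℝ, C / h ^ 4 = C * y ^ 4 := fun C => by rw [hy]; field_simp
  rw [hC4]
  have hsplit : y * (y ^ 2 * (k₂ ((x - s) / h) * a s) + y * (k₁ ((x - s) / h) * b s)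
      + k ((x - s) / h) * c s) - y * (y ^ 2 * (k₂ ((x - s') / h) * a s')
      + y * (k₁ ((x - s') / h) * b s') + k ((x - s') / h) * c s') = y ^ 3 * (k₂ ((x - s) / h) * a s
      - k₂ ((x - s') / h) * a s')
      + y ^ 2 * (k₁ ((x - s) / h) * b s - k₁ ((x - s') / h) * b s')
      + y * (k ((x - s) / h) * c s - k ((x - s') / h) * c s') := by
    ring
  rw [hsplit]
  refine (abs_add_three _ _ _).trans ?_
  rw [abs_mul, abs_mul, abs_mul, abs_of_nonneg hy0, abs_of_nonneg (pow_nonneg hy0 3),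
    abs_of_nonneg (pow_nonneg hy0 2)]
  have p3 : y ^ 3 ≤ y ^ 4 := pow_le_pow_right₀ hinv (by norm_num)
  have p2 : y ^ 2 ≤ y ^ 4 := pow_le_pow_right₀ hinv (by norm_num)
  calc _ ≤ y ^ 3 * (C₂ * y * d) + y ^ 2 * (C₁ * y * d) + y * (C₀ * y * d) := by gcongr
    _ = C₂ * d * y ^ 4 + C₁ * d * y ^ 3 + C₀ * d * y ^ 2 := by ring
    _ ≤ C₂ * d * y ^ 4 + C₁ * d * y ^ 4 + C₀ * d * y ^ 4 := by gcongr
    _ = (C₂ + C₁ + C₀) * y ^ 4 * d := by ring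

/-- The outermost active design points lie within `κ / n` of the ends of the window. -/
lemma design_endpoint_gap {f : ℝ → ℝ} {cf : ℝ} (hcf : 0 < cf)
    (hf_lb : ∀ s ∈ Set.Icc (0 : ℝ) 1, cf ≤ f s) (hf : ContinuousOn f (Set.Icc 0 1))
    (hf_density : ∫ s in (0 : ℝ)..1, f s = 1) {τ : ℕ → ℝ} {n p q : ℕ} {x h : ℝ}
    (hτ_mem : ∀ i, 1 ≤ i → i ≤ n → τ i ∈ Set.Icc (0 : ℝ) 1)
    (hτ_def : ∀ i : ℕ, 1 ≤ i → i ≤ n → ∫ s in (0 : ℝ)..(τ i), f s = (i : ℝ) / n)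
    (hn : 1 ≤ n) (hsub : x - h ∈ Set.Icc (0 : ℝ) 1 ∧ x + h ∈ Set.Icc (0 : ℝ) 1)
    (hp : 1 ≤ p) (hpq : p < q) (hq : q ≤ n)
    (htp : x - h ≤ τ p) (htq : τ q ≤ x + h)
    (hp' : p = 1 ∨ τ (p - 1) < x - h) (hq' : q = n ∨ x + h < τ (q + 1)) :
    |τ p - (x - h)| ≤ cf⁻¹ * (1 / n) ∧ |τ q - (x + h)| ≤ cf⁻¹ * (1 / n) := by
  have hn0 : (0 : ℝ) < n := by exact_mod_cast hn
  have hgap : ∀ a ∈ Set.Icc (0 : ℝ) 1, ∀ b ∈ Set.Icc (0 : ℝ) 1, a ≤ b →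
      (∫ r in (0 : ℝ)..b, f r) - (∫ r in (0 : ℝ)..a, f r) ≤ 1 / n →
      b - a ≤ cf⁻¹ * (1 / n) := by
    intro a ha b hb hab h
    rw [inv_mul_eq_div, le_div_iff₀ hcf, mul_comm]
    exact (mul_sub_le_integral_sub hf hf_lb ha hb hab).trans h
  have hstep : ∀ i : ℕ, ((i + 1 : ℕ) : ℝ) / n - (i : ℝ) / n = 1 / n := fun i => by
    push_cast; ring
  constructor
  · rw [abs_of_nonneg (by linarith)]
    by_cases hp1 : p = 1
    · subst hp1
      have := hgap 0 (by simp) (τ 1) (hτ_mem 1 le_rfl hn) (hτ_mem 1 le_rfl hn).1 (by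
        rw [hτ_def 1 le_rfl hn]; simp)
      linarith [hsub.1.1]
    · have hp' := hp'.resolve_left hp1
      obtain ⟨r, rfl⟩ : ∃ r, p = r + 1 := ⟨p - 1, by omega⟩
      rw [Nat.add_sub_cancel] at hp'
      have := hgap (τ r) (hτ_mem r (by omega) (by omega)) (τ (r + 1))
        (hτ_mem _ (by omega) (by omega)) (by linarith) (by
          rw [hτ_def _ (by omega) (by omega), hτ_def _ (by omega) (by omega), hstep])
      linarith
  · rw [abs_of_nonpos (by linarith)]
    by_cases hqn : q = n
    · have := hgap (τ q) (hτ_mem q (by omega) hq) 1 (by simp) (hτ_mem q (by omega) hq).2 (by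
        rw [hf_density, hτ_def q (by omega) hq, hqn, div_self hn0.ne', sub_self]; positivity)
      linarith [hsub.2.2]
    · have hq' := hq'.resolve_left hqn
      have := hgap (τ q) (hτ_mem q (by omega) hq) (τ (q + 1))
        (hτ_mem _ (by omega) (by omega)) (by linarith) (by
          rw [hτ_def _ (by omega) (by omega), hτ_def _ (by omega) (by omega), hstep])
      linarith

/-- The trapezoidal sum approximates the smoothed regression function to order `(n h)⁻³`. -/
lemma trapSum_sub_integral_le
    {f : ℝ → ℝ} {cf : ℝ} (hcf : 0 < cf)
    (hf_lb : ∀ s ∈ Set.Icc (0 : ℝ) 1, cf ≤ f s)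
    (hf : ContDiffOn ℝ 2 f (Set.Icc 0 1))
    (hf_lip : ∃ L : NNReal,
      LipschitzOnWith L (iteratedDerivWithin 2 f (Set.Icc 0 1)) (Set.Icc 0 1))
    (hf_density : ∫ s in (0 : ℝ)..1, f s = 1)
    {t : ℕ → ℕ → ℝ}
    (ht_mem : ∀ n i : ℕ, 1 ≤ i → i ≤ n → t n i ∈ Set.Icc (0 : ℝ) 1)
    (ht_def : ∀ n i : ℕ, 1 ≤ i → i ≤ n → ∫ s in (0 : ℝ)..(t n i), f s = (i : ℝ) / n)
    (ht_mono : ∀ n : ℕ, StrictMonoOn (t n) (Set.Icc 1 n))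
    {g : ℝ → ℝ} (hg : ContDiffOn ℝ 2 g (Set.Icc 0 1))
    (hg_lip : ∃ L : NNReal,
      LipschitzOnWith L (iteratedDerivWithin 2 g (Set.Icc 0 1)) (Set.Icc 0 1))
    {K : ℝ → ℝ} (hK_supp : ∀ u : ℝ, u ∉ Set.Icc (-1 : ℝ) 1 → K u = 0)
    (hK : ContDiff ℝ 2 K)
    (hK_lip : ∃ L : NNReal, LipschitzOnWith L (iteratedDeriv 2 K) (Set.Icc (-1 : ℝ) 1)) :
    ∃ C, 0 ≤ C ∧ ∀ (n : ℕ) (x h : ℝ), 1 ≤ n → 0 < h → h < 1 → 1 ≤ (n : ℝ) * h →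
      Set.Icc (x - h) (x + h) ⊆ Set.Icc (0 : ℝ) 1 → (trapIdx t n x h).Nonempty →
      |trapSum t n x h (fun s => phiK K x h s * g s / f s)
        - ∫ s in (x - h)..(x + h), phiK K x h s * g s| ≤ C / ((n : ℝ) ^ 3 * h ^ 3) := by
  obtain ⟨A, m, a, b, c, BA, Bm, Ba, Bb, Bc, hq, hA, hm, hqA, hAa⟩ :=
    exists_design_weights hcf hf_lb hf hf_lip hg hg_lip
  obtain ⟨L, hL, hend⟩ := kernel_endpoint_bounds hK hK_supp hK_lip
  obtain ⟨hK1, hK2⟩ := hK.hasDerivAt_chain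
  have hK2c : Continuous (iteratedDeriv 2 K) := hK.continuous_iteratedDeriv 2 (by norm_num)
  have BK2 : IsBddLip (Set.Icc (-1) 1) (iteratedDeriv 2 K) :=
    hK_lip.elim fun _ h => IsBddLip.of_lipschitzOnWith isCompact_Icc h
  have BK1 : IsBddLip (Set.Icc (-1) 1) (deriv K) := IsBddLip.of_hasDerivWithinAt isCompact_Icc
    (convex_Icc _ _) (fun s _ => (hK2 s).hasDerivWithinAt) hK2c.continuousOn
  have BK : IsBddLip (Set.Icc (-1) 1) K := IsBddLip.of_hasDerivWithinAt isCompact_Icc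
    (convex_Icc _ _) (fun s _ => (hK1 s).hasDerivWithinAt)
    (hK.continuous_deriv (by norm_num)).continuousOn
  obtain ⟨CE, hCE, hE⟩ := BK2.scaled_combination BK1 BK Ba Bb Bc
  obtain ⟨MA, hMA, hAb, -⟩ := BA
  obtain ⟨Mm, hMm, hmb, -⟩ := Bm
  obtain ⟨Mf, hMf⟩ := (isCompact_Icc (a := (0 : ℝ)) (b := 1)).exists_bound_of_continuousOn
    hf.continuousOn
  obtain ⟨Mg, hMg⟩ := (isCompact_Icc (a := (0 : ℝ)) (b := 1)).exists_bound_of_continuousOn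
    hg.continuousOn
  have hMf0 : 0 ≤ Mf := (norm_nonneg _).trans (hMf 0 (by simp))
  have hMg0 : 0 ≤ Mg := (norm_nonneg _).trans (hMg 0 (by simp))
  have hfne : ∀ s ∈ Set.Icc (0 : ℝ) 1, f s ≠ 0 := fun s hs => (hcf.trans_le (hf_lb s hs)).ne'
  obtain ⟨κ, hκ⟩ : ∃ κ, κ = cf⁻¹ := ⟨_, rfl⟩
  have hκ0 : 0 ≤ κ := by rw [hκ]; positivity
  refine ⟨2 * (CE * Mf * κ) + 2 * (L * (κ ^ 2 * MA + κ ^ 3 * Mm))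
    + 2 * (L * κ ^ 4 * Mg), by positivity, fun n x h hn hh hh1 hnh hsub hne => ?_⟩
  have hn0 : (0 : ℝ) < n := by exact_mod_cast hn
  obtain ⟨p, q, hp1, hpq, hqn, hidx, htp, htq, hpe, hqe⟩ := trapIdx_eq_Ico (ht_mono n) hne
  obtain ⟨hgapp, hgapq⟩ := design_endpoint_gap hcf hf_lb hf.continuousOn hf_density
    (ht_mem n) (ht_def n) hn
    ⟨hsub ⟨le_rfl, by linarith⟩, hsub ⟨by linarith, le_rfl⟩⟩ hp1 hpq hqn htp.1 htq.2 hpe hqe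
  rw [← hκ] at hgapp hgapq
  obtain ⟨z, hz⟩ : ∃ z, z = 1 / ((n : ℝ) * h) := ⟨_, rfl⟩
  have hz0 : 0 ≤ z := by rw [hz]; positivity
  have hz1 : z ≤ 1 := by rw [hz, div_le_one (by positivity)]; exact hnh
  have hzh : 1 / (n : ℝ) = z * h := by rw [hz]; field_simp
  have hz4 : z ^ 4 ≤ z ^ 3 := pow_le_pow_of_le_one hz0 hz1 (by norm_num)
  obtain ⟨F, hFdef⟩ : ∃ F : ℝ → ℝ, F = fun s => ∫ r in (0 : ℝ)..s, f r := ⟨_, rfl⟩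
  obtain ⟨I, hIdef⟩ : ∃ I : ℝ → ℝ, I = fun s => ∫ r in (0 : ℝ)..s, phiK K x h r * g r := ⟨_, rfl⟩
  obtain ⟨G, hGdef⟩ : ∃ G : ℝ → ℝ, G = fun s => phiK K x h s * g s / f s := ⟨_, rfl⟩
  obtain ⟨D, hDdef⟩ : ∃ D : ℝ → ℝ, D = fun s => 1 / h * (-(1 / h) * (deriv K ((x - s) / h) * A s)
    + K ((x - s) / h) * m s) := ⟨_, rfl⟩
  obtain ⟨E, hEdef⟩ : ∃ E : ℝ → ℝ, E = fun s => 1 / h * ((1 / h) ^ 2 *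
    (iteratedDeriv 2 K ((x - s) / h) * a s) + 1 / h * (deriv K ((x - s) / h) * b s)
    + K ((x - s) / h) * c s) := ⟨_, rfl⟩
  have hφg : ContinuousOn (fun s => phiK K x h s * g s) (Set.Icc 0 1) := by
    have : Continuous (phiK K x h) := by
      unfold phiK
      exact continuous_const.mul (hK.continuous.comp (by fun_prop))
    exact this.continuousOn.mul hg.continuousOn
  have hF : ∀ s ∈ Set.Icc (0 : ℝ) 1, HasDerivWithinAt F (f s) (Set.Icc 0 1) s := by
    rw [hFdef]; exact hasDerivWithinAt_integral_Icc hf.continuousOn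
  have hI : ∀ s ∈ Set.Icc (0 : ℝ) 1, HasDerivWithinAt I (G s * f s) (Set.Icc 0 1) s := by
    intro s hs
    rw [hIdef, hGdef]
    refine (hasDerivWithinAt_integral_Icc hφg s hs).congr_deriv ?_
    exact (div_mul_cancel₀ _ (hfne s hs)).symm
  have hG : ∀ s ∈ Set.Icc (0 : ℝ) 1, HasDerivWithinAt G (D s * f s) (Set.Icc 0 1) s := by
    intro s hs
    have hGeq : G = fun s => 1 / h * (K ((x - s) / h) * (g s / f s)) := by
      rw [hGdef]; funext s; rw [phiK]; ring
    rw [hGeq, hDdef]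
    refine ((hasDerivWithinAt_scaled_mul (x := x) (h := h) hK1 (hq s hs)).const_mul
      (1 / h)).congr_deriv ?_
    rw [hqA s hs]
    ring
  have hD : ∀ s ∈ Set.Icc (0 : ℝ) 1, HasDerivWithinAt D (E s * f s) (Set.Icc 0 1) s := by
    intro s hs
    rw [hDdef, hEdef]
    refine ((((hasDerivWithinAt_scaled_mul (x := x) (h := h) hK2 (hA s hs)).const_mul
      (-(1 / h))).add (hasDerivWithinAt_scaled_mul (x := x) (h := h) hK1 (hm s hs))).const_mul
      (1 / h)).congr_deriv ?_
    rw [hAa s hs]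
    ring
  have hElip : ∀ s ∈ Set.Icc (x - h) (x + h), ∀ s' ∈ Set.Icc (x - h) (x + h),
      |E s - E s'| ≤ CE / h ^ 4 * |s - s'| := by
    rw [hEdef]; exact hE x h hh hh1 hsub
  have hnear : ∀ e : ℝ, e = 1 ∨ e = -1 → ∀ s ∈ Set.Icc (x - h) (x + h),
      |s - (x - h * e)| ≤ κ * (1 / n) →
      |deriv K ((x - s) / h)| ≤ L * (κ * z) ^ 2 ∧ |K ((x - s) / h)| ≤ L * (κ * z) ^ 3 := by
    intro e he s hs hse
    have hv : (x - s) / h ∈ Set.Icc (-1 : ℝ) 1 := by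
      rw [Set.mem_Icc, le_div_iff₀ hh, div_le_iff₀ hh]
      constructor <;> linarith [hs.1, hs.2]
    have hd : |(x - s) / h - e| ≤ κ * z := by
      have : (x - s) / h - e = -((s - (x - h * e)) / h) := by field_simp; ring
      rw [this, abs_neg, abs_div, abs_of_pos hh, div_le_iff₀ hh, mul_assoc, ← hzh]
      exact hse
    obtain ⟨h1, h2⟩ := hend e he _ hv
    exact ⟨h1.trans (by gcongr), h2.trans (by gcongr)⟩
  have hDsmall : ∀ e : ℝ, e = 1 ∨ e = -1 → ∀ s ∈ Set.Icc (x - h) (x + h),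
      |s - (x - h * e)| ≤ κ * (1 / n) →
      (1 / (n : ℝ)) ^ 2 / 12 * |D s| ≤ L * (κ ^ 2 * MA + κ ^ 3 * Mm) * z ^ 3 := by
    intro e he s hs hse
    obtain ⟨h1, h2⟩ := hnear e he s hs hse
    have hD' : h ^ 2 * D s = -(deriv K ((x - s) / h) * A s) + h * (K ((x - s) / h) * m s) := by
      rw [hDdef]; field_simp
    have hD'' : h ^ 2 * |D s| ≤ L * (κ * z) ^ 2 * MA + 1 * (L * (κ * z) ^ 3 * Mm) := by
      rw [← abs_of_nonneg (sq_nonneg h), ← abs_mul, hD']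
      refine (abs_add_le _ _).trans ?_
      rw [abs_neg, abs_mul, abs_mul, abs_mul, abs_of_pos hh]
      have e1 := hAb s (hsub hs)
      have e2 := hmb s (hsub hs)
      gcongr
    calc (1 / (n : ℝ)) ^ 2 / 12 * |D s| = z ^ 2 / 12 * (h ^ 2 * |D s|) := by rw [hzh]; ring
      _ ≤ z ^ 2 / 12 * (L * (κ * z) ^ 2 * MA + 1 * (L * (κ * z) ^ 3 * Mm)) := by gcongr
      _ = (L * κ ^ 2 * MA * z ^ 4 + L * κ ^ 3 * Mm * (z ^ 4 * z)) / 12 := by ring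
      _ ≤ (L * κ ^ 2 * MA * z ^ 3 + L * κ ^ 3 * Mm * (z ^ 3 * 1)) / 12 := by gcongr
      _ = L * (κ ^ 2 * MA + κ ^ 3 * Mm) * z ^ 3 / 12 := by ring
      _ ≤ L * (κ ^ 2 * MA + κ ^ 3 * Mm) * z ^ 3 := div_le_self (by positivity) (by norm_num)
  have hIsmall : ∀ e : ℝ, e = 1 ∨ e = -1 → ∀ s ∈ Set.Icc (x - h) (x + h),
      |s - (x - h * e)| ≤ κ * (1 / n) → |I s - I (x - h * e)| ≤ L * κ ^ 4 * Mg * z ^ 3 := by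
    intro e he s hs hse
    have heI : x - h * e ∈ Set.Icc (x - h) (x + h) := by
      rcases he with rfl | rfl <;> constructor <;> linarith
    have hIeq : I s - I (x - h * e) = ∫ r in (x - h * e)..s, phiK K x h r * g r := by
      rw [hIdef]; exact integral_sub_eq_of_mem_Icc hφg (hsub heI) (hsub hs)
    have hbd := intervalIntegral.norm_integral_le_of_norm_le_const (a := x - h * e) (b := s)
      (C := 1 / h * (L * (κ * z) ^ 3) * Mg) (f := fun r => phiK K x h r * g r) fun r hr => by
        have hr' := Set.uIoc_subset_uIcc hr
        have hrI : r ∈ Set.Icc (x - h) (x + h) := Set.uIcc_subset_Icc heI hs hr'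
        obtain ⟨-, h2⟩ := hnear e he r hrI ((Set.abs_sub_left_of_mem_uIcc hr').trans hse)
        rw [norm_mul, phiK, norm_mul, Real.norm_of_nonneg (by positivity : 0 ≤ 1 / h)]
        have e1 := hMg r (hsub hrI)
        rw [← Real.norm_eq_abs] at h2
        gcongr
    rw [hIeq, ← Real.norm_eq_abs]
    calc _ ≤ 1 / h * (L * (κ * z) ^ 3) * Mg * (κ * (z * h)) := by
          refine hbd.trans ?_
          rw [← hzh]
          gcongr
      _ = L * κ ^ 4 * Mg * z ^ 4 := by field_simp
      _ ≤ L * κ ^ 4 * Mg * z ^ 3 := by gcongr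
  have hcell : ∀ i ∈ Finset.Ico p q,
      |1 / (n : ℝ) / 2 * (G (t n i) + G (t n (i + 1)))
        - (1 / (n : ℝ)) ^ 2 / 12 * (D (t n (i + 1)) - D (t n i))
        - (I (t n (i + 1)) - I (t n i))|
      ≤ CE / h ^ 4 * Mf * κ * (1 / (n : ℝ)) ^ 3 * (t n (i + 1) - t n i) := by
    intro i hi
    have hi' := hi
    rw [← hidx] at hi'
    simp only [trapIdx, Finset.mem_filter] at hi'
    obtain ⟨hi1, hi2⟩ := Finset.mem_Ico.1 hi
    have hlt : t n i ≤ t n (i + 1) := (ht_mono n).monotoneOn ⟨by omega, by omega⟩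
      ⟨by omega, by omega⟩ (by omega)
    have hcs : Set.Icc (t n i) (t n (i + 1)) ⊆ Set.Icc (x - h) (x + h) :=
      Set.Icc_subset_Icc hi'.2.1.1 hi'.2.2.2
    have hcs' := hcs.trans hsub
    have hFn : ∀ u ∈ Set.Icc (0 : ℝ) 1, ∀ v ∈ Set.Icc (0 : ℝ) 1, u ≤ v →
        cf * (v - u) ≤ F v - F u := by
      rw [hFdef]
      exact fun u hu v hv huv => mul_sub_le_integral_sub hf.continuousOn hf_lb hu hv huv
    have hFm : ∀ u ∈ Set.Icc (0 : ℝ) 1, ∀ v ∈ Set.Icc (0 : ℝ) 1, u ≤ v → F u ≤ F v :=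
      fun u hu v hv huv => by nlinarith [hFn u hu v hv huv]
    have hl := hcs' (Set.left_mem_Icc.2 hlt)
    have hr := hcs' (Set.right_mem_Icc.2 hlt)
    have hmass : F (t n (i + 1)) - F (t n i) = 1 / (n : ℝ) := by
      rw [hFdef]
      simp only
      rw [ht_def n _ (by omega) (by omega), ht_def n _ (by omega) (by omega)]
      push_cast
      ring
    refine trapezoid_cell_error (F := F) (f := f) (E := E) hlt
      (fun s hs => (hF s (hcs' hs)).mono hcs') (fun s hs => (hG s (hcs' hs)).mono hcs')
      (fun s hs => (hD s (hcs' hs)).mono hcs') (fun s hs => (hI s (hcs' hs)).mono hcs')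
      (fun s hs => hElip s (hcs hs) _ (hcs (Set.left_mem_Icc.2 hlt))) (by positivity)
      (fun s hs => hMf s (hcs' hs)) hmass
      (fun s hs => ⟨hFm _ hl _ (hcs' hs) hs.1, hFm _ (hcs' hs) _ hr hs.2⟩) ?_
    rw [hκ, inv_mul_eq_div, le_div_iff₀ hcf, mul_comm, ← hmass]
    exact hFn _ hl _ hr hlt
  have hsum := trapezoid_sum_error (τ := t n) (G := G) (D := D) (I := I) hpq.le hcell
  have hts : trapSum t n x h (fun s => phiK K x h s * g s / f s)
      = 1 / (n : ℝ) / 2 * ∑ i ∈ Finset.Ico p q, (G (t n i) + G (t n (i + 1))) := by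
    rw [trapSum, hidx, hGdef]
    congr 1
    ring
  have hIint : ∫ s in (x - h)..(x + h), phiK K x h s * g s = I (x + h) - I (x - h) := by
    rw [hIdef]
    exact (integral_sub_eq_of_mem_Icc hφg (hsub ⟨le_rfl, by linarith⟩)
      (hsub ⟨by linarith, le_rfl⟩)).symm
  have hmain : CE / h ^ 4 * Mf * κ * (1 / (n : ℝ)) ^ 3 * (t n q - t n p)
      ≤ 2 * (CE * Mf * κ) * z ^ 3 := by
    calc _ ≤ CE / h ^ 4 * Mf * κ * (1 / (n : ℝ)) ^ 3 * (2 * h) := by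
          have : t n q - t n p ≤ 2 * h := by linarith [htq.2, htp.1]
          gcongr
      _ = 2 * (CE * Mf * κ) * z ^ 3 := by rw [hzh]; field_simp
  have hDp := hDsmall 1 (Or.inl rfl) _ htp (by rwa [mul_one])
  have hDq := hDsmall (-1) (Or.inr rfl) _ htq (by rwa [mul_neg, mul_one, sub_neg_eq_add])
  have hIp := hIsmall 1 (Or.inl rfl) _ htp (by rwa [mul_one])
  have hIq := hIsmall (-1) (Or.inr rfl) _ htq (by rwa [mul_neg, mul_one, sub_neg_eq_add])
  rw [mul_one] at hIp
  rw [mul_neg, mul_one, sub_neg_eq_add] at hIq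
  have hCz : ∀ C : ℝ, C / ((n : ℝ) ^ 3 * h ^ 3) = C * z ^ 3 := fun C => by
    rw [hz]; field_simp
  rw [hts, hIint, hCz]
  set T := 1 / (n : ℝ) / 2 * ∑ i ∈ Finset.Ico p q, (G (t n i) + G (t n (i + 1)))
  set ν := (1 / (n : ℝ)) ^ 2 / 12 with hν
  have hν0 : 0 ≤ ν := by positivity
  rw [← abs_of_nonneg hν0, ← abs_mul] at hDp hDq
  have hfin := hsum.trans hmain
  rw [abs_le] at hfin hDp hDq hIp hIq ⊢
  constructor <;> linarith [hfin.1, hfin.2, hDp.1, hDp.2, hDq.1, hDq.2, hIp.1, hIp.2, hIq.1, hIq.2]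

/- STATEMENT 5 (bias of the trapezoidal estimator): under the assumptions of
   the bias proposition, with B = ∫_{−1}^1 t²K(t)dt and
   Bias_{n,h}(x) = (1/(2n)) Σ_{k=1}^{N−1}[(φ·g/f)(t_{x,k}) + (φ·g/f)(t_{x,k+1})] − g(x),
   there exist C > 0 and ρ(h) → 0 (h → 0⁺) such that for all n, h with nh ≥ 1
   and [x−h,x+h] ⊆ [0,1],
   |Bias_{n,h}(x) − (1/2)h²g''(x)B| ≤ ρ(h)h² + C/(n³h³);
   i.e. Bias = (1/2)h²g''(x)B + o(h²) + O(1/(n³h³)). -/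

theorem trapezoidal_estimator_bias
    (f : ℝ → ℝ) (cf : ℝ) (hcf : 0 < cf)
    (hf_lb : ∀ s ∈ Set.Icc (0:ℝ) 1, cf ≤ f s)
    (hf_smooth : ContDiffOn ℝ 2 f (Set.Icc 0 1))
    (hf''_lip : ∃ L : NNReal,
      LipschitzOnWith L (iteratedDerivWithin 2 f (Set.Icc 0 1)) (Set.Icc 0 1))
    (hf_density : ∫ s in (0:ℝ)..1, f s = 1)
    (t : ℕ → ℕ → ℝ)
    (ht_mem : ∀ n i : ℕ, 1 ≤ i → i ≤ n → t n i ∈ Set.Icc (0:ℝ) 1)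
    (ht_def : ∀ n i : ℕ, 1 ≤ i → i ≤ n →
      ∫ s in (0:ℝ)..(t n i), f s = (i : ℝ) / n)
    (ht_mono : ∀ n : ℕ, StrictMonoOn (t n) (Set.Icc 1 n))
    (g : ℝ → ℝ)
    (hg_smooth : ContDiffOn ℝ 2 g (Set.Icc 0 1))
    (hg''_lip : ∃ L : NNReal,
      LipschitzOnWith L (iteratedDerivWithin 2 g (Set.Icc 0 1)) (Set.Icc 0 1))
    (K : ℝ → ℝ)
    (hK_even : ∀ u : ℝ, K (-u) = K u)
    (hK_supp : ∀ u : ℝ, u ∉ Set.Icc (-1:ℝ) 1 → K u = 0)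
    (hK_smooth : ContDiff ℝ 2 K)
    (hK''_lip : ∃ L : NNReal,
      LipschitzOnWith L (iteratedDeriv 2 K) (Set.Icc (-1:ℝ) 1))
    (hK_int : ∫ u in (-1:ℝ)..1, K u = 1)
    (x : ℝ) (hx : x ∈ Set.Ioo (0:ℝ) 1) :
    ∃ (C : ℝ) (ρ : ℝ → ℝ), 0 < C ∧ (∀ s, 0 ≤ ρ s) ∧
      Tendsto ρ (𝓝[>] (0:ℝ)) (𝓝 0) ∧
      ∀ (n : ℕ) (h : ℝ), 1 ≤ n → 0 < h → h < 1 → 1 ≤ (n : ℝ) * h →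
        Set.Icc (x - h) (x + h) ⊆ Set.Icc (0:ℝ) 1 →
        (trapIdx t n x h).Nonempty →
        |(trapSum t n x h (fun s => phiK K x h s * g s / f s) - g x)
            - (1 / 2) * h ^ 2 * iteratedDerivWithin 2 g (Set.Icc 0 1) x
                * (∫ u in (-1:ℝ)..1, u ^ 2 * K u)|
          ≤ ρ h * h ^ 2 + C / ((n : ℝ) ^ 3 * h ^ 3) := by
  obtain ⟨C, hC, hquad⟩ := trapSum_sub_integral_le hcf hf_lb hf_smooth hf''_lip hf_density ht_mem
    ht_def ht_mono hg_smooth hg''_lip hK_supp hK_smooth hK''_lip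
  obtain ⟨C', hC', hbias⟩ := kernel_smoothing_expansion hg_smooth hg''_lip hK_smooth.continuous
    hK_even hK_int
  refine ⟨C + 1, fun s => C' * |s|, by positivity, fun s => by positivity, ?_, ?_⟩
  · have : Tendsto (fun s : ℝ => C' * |s|) (𝓝 0) (𝓝 (C' * |0|)) :=
      Continuous.tendsto (by fun_prop) 0
    rw [abs_zero, mul_zero] at this
    exact this.mono_left nhdsWithin_le_nhds
  · intro n h hn hh hh1 hnh hsub hne
    have h1 := hquad n x h hn hh hh1 hnh hsub hne
    have h2 := hbias x h hh hsub
    have hn0 : (0 : ℝ) < n := by exact_mod_cast hn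
    have h3 : C / ((n : ℝ) ^ 3 * h ^ 3) ≤ (C + 1) / ((n : ℝ) ^ 3 * h ^ 3) := by gcongr; linarith
    have h4 : C' * |h| * h ^ 2 = C' * h ^ 3 := by rw [abs_of_pos hh]; ring
    simp only [h4]
    rw [abs_le] at h1 h2 ⊢
    constructor <;> linarith [h1.1, h1.2, h2.1, h2.2]
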